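/- arXiv:math/0109065 — 3 statements merged into one kernel-verified Lean document; each statement's English description precedes it below -/
import Mathlib

section
/- Let M be a compact connected topological space, let f : M → ℂ be a continuous function, and let C ⊆ M be a closed subset such that the restriction of f to M \ C is an open map and the image f(C) is countable. Then f is constant on M. -/
/-- Where the restriction of a map to the complement of `C` is open, the frontier of the range
can only be reached from `C`. -/
theorem frontier_range_subset_image {X Y : Type*} [TopologicalSpace X] [TopologicalSpace Y]
    {f : X → Y} {C : Set X} (hrange : IsClosed (Set.range f))
    (hopen : IsOpenMap (Cᶜ.domRestrict f)) : frontier (Set.range f) ⊆ f '' C := by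
  intro y hy
  obtain ⟨x, rfl⟩ := hrange.frontier_subset hy
  by_contra hx
  have hxC : x ∈ Cᶜ := fun h => hx ⟨x, h, rfl⟩
  have hsub : Set.range (Cᶜ.domRestrict f) ⊆ Set.range f := by
    rintro _ ⟨z, rfl⟩
    exact ⟨z, rfl⟩
  exact hy.2 (interior_maximal hsub hopen.isOpen_range ⟨⟨x, hxC⟩, rfl⟩)

/-- A compact subset of a real vector space of dimension `> 1` is countable if its frontier is. -/
theorem IsCompact.countable_of_countable_frontier {E : Type*} [NormedAddCommGroup E]
    [NormedSpace ℝ E] (hE : 1 < Module.rank ℝ E) [NoncompactSpace E] {K : Set E}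
    (hK : IsCompact K) (hfr : (frontier K).Countable) : K.Countable := by
  have hconn := (hfr.isConnected_compl_of_one_lt_rank hE).isPreconnected
  have hdisj : Disjoint Kᶜ (interior K) :=
    Set.disjoint_compl_left_iff_subset.2 interior_subset
  have hcover : (frontier K)ᶜ ⊆ Kᶜ ∪ interior K := by
    rw [compl_frontier_eq_union_interior, Set.union_comm]
    exact Set.union_subset_union_left _ interior_subset
  have hsub : Kᶜ ⊆ (frontier K)ᶜ := Set.compl_subset_compl.2 hK.isClosed.frontier_subset
  obtain ⟨z, hz⟩ := Set.nonempty_compl.2 hK.ne_univ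
  have hleft := hconn.subset_left_of_subset_union hK.isClosed.isOpen_compl isOpen_interior
    hdisj hcover ⟨z, hsub hz, hz⟩
  exact hfr.mono (Set.compl_subset_compl.1 hleft)


/-- If `M` is a compact connected topological space, `f : M → ℂ` is
continuous, `C ⊆ M` is closed, the restriction of `f` to `M \ C` is an open map,
and `f(C)` is countable, then `f` is constant on `M`. -/
theorem stmt_0 {M : Type*} [TopologicalSpace M] [CompactSpace M] [ConnectedSpace M]
    (f : M → ℂ) (hf : Continuous f) (C : Set M) (hC : IsClosed C)
    (hopen : IsOpenMap (Cᶜ.restrict f)) (hcount : (f '' C).Countable) :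
    ∀ x y : M, f x = f y := by
  have hK : IsCompact (Set.range f) := isCompact_range hf
  have hfr := hcount.mono (frontier_range_subset_image hK.isClosed hopen)
  have hrank : 1 < Module.rank ℝ ℂ := by simp
  have hrange := hK.countable_of_countable_frontier hrank hfr
  intro x y
  exact hrange.isTotallyDisconnected _ subset_rfl (isPreconnected_range hf) ⟨x, rfl⟩ ⟨y, rfl⟩
end

section
/- Let M be a compact topological space, f : M → ℂ a continuous function, and C ⊆ M a closed subset such that the restriction of f to M \ C is an open map. Then the topological frontier (boundary) of the open set f(M \ C) ⊆ ℂ is contained in the image f(C). -/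
/-- If `M` is compact, `f : M → ℂ` is continuous, `C ⊆ M` is closed
and the restriction of `f` to `M \ C` is an open map, then the frontier of the
open set `f(M \ C)` is contained in `f(C)`. -/
theorem stmt_1 {M : Type*} [TopologicalSpace M] [CompactSpace M]
    (f : M → ℂ) (hf : Continuous f) (C : Set M) (hC : IsClosed C)
    (hopen : IsOpenMap (Cᶜ.restrict f)) :
    frontier (f '' Cᶜ) ⊆ f '' C := by
  have hU : IsOpen (f '' Cᶜ) := by
    rw [← Set.range_domRestrict]
    exact hopen.isOpen_range
  intro z hz
  rw [hU.frontier_eq] at hz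
  obtain ⟨x, rfl⟩ : z ∈ Set.range f :=
    closure_minimal (Set.image_subset_range f Cᶜ) (isCompact_range hf).isClosed hz.1
  by_contra hx
  exact hz.2 ⟨x, fun hxC => hx ⟨x, hxC, rfl⟩, rfl⟩
end

section
/- A nonempty bounded open subset of ℂ cannot have a countable frontier (boundary). Equivalently: if U ⊆ ℂ is open, bounded, and its frontier is countable, then U is empty. -/
/-- A nonempty bounded open subset of `ℂ` cannot have countable
frontier: if `U ⊆ ℂ` is open, bounded, and its frontier is countable, then `U`
is empty. -/
theorem stmt_2 (U : Set ℂ) (hU : IsOpen U) (hbdd : Bornology.IsBounded U)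
    (hcount : (frontier U).Countable) : U = ∅ := by
  by_contra hne
  obtain ⟨x, hx⟩ := Set.nonempty_iff_ne_empty.mpr hne
  have hconn : IsPreconnected (frontier U)ᶜ :=
    (hcount.isConnected_compl_of_one_lt_rank (by simp)).isPreconnected
  obtain ⟨y, hy⟩ : ∃ y, y ∉ closure U := by
    rw [← Set.ne_univ_iff_exists_notMem]
    exact fun h => NormedSpace.unbounded_univ ℂ ℂ (h ▸ hbdd.closure)
  rw [hU.frontier_eq] at hconn
  obtain ⟨z, -, hzU, hz⟩ := hconn U (closure U)ᶜ hU isClosed_closure.isOpen_compl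
    (fun z hz => by by_cases h : z ∈ closure U <;> simp_all)
    ⟨x, fun h => h.2 hx, hx⟩ ⟨y, fun h => hy h.1, hy⟩
  exact hz (subset_closure hzU)
end
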